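/- Let G be an oriented indifference graph with a fixed oriented perfect elimination ordering, let (h_u)_{u∈V} be a Hamiltonian compatible with G, let χ be a simplicial mode, let ε_k and ε_l be single-particle energies, and let N_k, N_l be nonzero complex constants. If ε_k^d ≠ ε_l^d, then for all p, q ∈ ℤ, (ω^p ε_k − ω^{q+1} ε_l) · ψ_{p,k} ψ_{q,l} = −(ω^q ε_l − ω^{p+1} ε_k) · ψ_{q,l} ψ_{p,k}. Moreover, for all p, q ∈ ℤ with p ≢ q+1 (mod d), ψ_{p,k} ψ_{q,k} = 0. -/

import Mathlib

noncomputable section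
open scoped Classical

/-- `ω = exp(2πi/d)`, the primitive `d`-th root of unity. -/
def omegaD (d : ℕ) : ℂ := Complex.exp (2 * Real.pi * Complex.I / d)

/-- A finite set of vertices is independent if its elements are pairwise non-adjacent. -/
def IsIndep {V : Type*} (G : SimpleGraph V) (S : Finset V) : Prop :=
  ∀ u ∈ S, ∀ w ∈ S, u ≠ w → ¬ G.Adj u w

/-- The independence number `α` of the induced subgraph of `G` on the vertex set `A`. -/
def indepNum {V : Type*} (G : SimpleGraph V) (A : Finset V) : ℕ :=
  (A.powerset.filter (fun S => IsIndep G S)).sup Finset.card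

/-- The ordered product `∏_{v ∈ S} h v` (in increasing order of vertices). -/
def hProd {V : Type*} [LinearOrder V] {N : ℕ} (h : V → Matrix (Fin N) (Fin N) ℂ)
    (S : Finset V) : Matrix (Fin N) (Fin N) ℂ :=
  ((S.sort (· ≤ ·)).map h).prod

/-- The independent set charge `Q^{(i)}` of the induced subgraph on `A`. -/
def chargeQ {V : Type*} [LinearOrder V] {N : ℕ} (G : SimpleGraph V)
    (h : V → Matrix (Fin N) (Fin N) ℂ) (A : Finset V) (i : ℕ) :
    Matrix (Fin N) (Fin N) ℂ :=
  ∑ S ∈ A.powerset.filter (fun S => IsIndep G S ∧ S.card = i), hProd h S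

/-- The transfer operator `T(x) = ∑_{k=0}^{α} (−x)^k Q^{(k)}` of the induced subgraph on `A`. -/
def transferT {V : Type*} [LinearOrder V] {N : ℕ} (G : SimpleGraph V)
    (h : V → Matrix (Fin N) (Fin N) ℂ) (A : Finset V) (x : ℂ) :
    Matrix (Fin N) (Fin N) ℂ :=
  ∑ k ∈ Finset.range (indepNum G A + 1), (-x) ^ k • chargeQ G h A k
/-- An induced path `p 0, p 1, …, p n` in `G`: the vertices are distinct and two of them
are adjacent if and only if they are consecutive. -/
def IsInducedPath {V : Type*} (G : SimpleGraph V) {n : ℕ} (p : Fin (n + 1) → V) : Prop :=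
  Function.Injective p ∧
    ∀ i j : Fin (n + 1), G.Adj (p i) (p j) ↔ ((i : ℕ) + 1 = (j : ℕ) ∨ (j : ℕ) + 1 = (i : ℕ))

/-- A path is a dipath if all of its edges are oriented consistently from one end to the other. -/
def IsDipath {V : Type*} (dir : V → V → Prop) {n : ℕ} (p : Fin (n + 1) → V) : Prop :=
  (∀ i : Fin n, dir (p i.castSucc) (p i.succ)) ∨ (∀ i : Fin n, dir (p i.succ) (p i.castSucc))

/-- An oriented graph is dipath oriented if every induced path is a dipath. -/
def DipathOriented {V : Type*} (G : SimpleGraph V) (dir : V → V → Prop) : Prop :=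
  ∀ (n : ℕ) (p : Fin (n + 1) → V), IsInducedPath G p → IsDipath dir p
/-- The independence polynomial `Z(x) = ∑_{I independent} ∏_{u ∈ I} x·w u`
of the induced subgraph on `A`, with vertex weights `w`. -/
def indepPoly {V : Type*} (G : SimpleGraph V) (w : V → ℂ) (A : Finset V) (x : ℂ) : ℂ :=
  ∑ S ∈ A.powerset.filter (fun S => IsIndep G S), ∏ u ∈ S, (x * w u)
/-- `f` is an oriented perfect elimination ordering of the oriented graph `(G, dir)`:
it is an injective labelling of the vertices such that for every vertex the earlier
neighbours form a clique, and every directed edge points forwards. -/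
def IsOPEO {V : Type*} (G : SimpleGraph V) (dir : V → V → Prop) (f : V → ℕ) : Prop :=
  Function.Injective f ∧
    (∀ v u w, G.Adj u v → G.Adj w v → f u < f v → f w < f v → u ≠ w → G.Adj u w) ∧
    (∀ u w, dir u w → f u < f w)
/-- `T^{≻p}(u) = ∏_{m=1}^{d−1} T(u·ω^{−p−m})`, factors in increasing order of `m`. -/
def transferTsucc {V : Type*} [LinearOrder V] {N : ℕ} (d : ℕ) (G : SimpleGraph V)
    (h : V → Matrix (Fin N) (Fin N) ℂ) (A : Finset V) (p : ℤ) (u : ℂ) :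
    Matrix (Fin N) (Fin N) ℂ :=
  ((List.range (d - 1)).map (fun m => transferT G h A (u * omegaD d ^ (-(p + (m : ℤ) + 1))))).prod

/-- The parafermionic mode `ψ_{p,k} = (1/N_k) T^p(ε_k⁻¹) χ T^{≻p}(ε_k⁻¹)`. -/
def paraMode {V : Type*} [Fintype V] [LinearOrder V] {N : ℕ} (d : ℕ) (G : SimpleGraph V)
    (h : V → Matrix (Fin N) (Fin N) ℂ) (χ : Matrix (Fin N) (Fin N) ℂ)
    (ε Nk : ℂ) (p : ℤ) : Matrix (Fin N) (Fin N) ℂ :=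
  Nk⁻¹ • (transferT G h Finset.univ (ε⁻¹ * omegaD d ^ (-p)) * χ *
    transferTsucc d G h Finset.univ p ε⁻¹)

section Alg
variable {M : Type*} [Ring M] [Algebra ℂ M]

/-- Reverse relation from the direct one. -/
theorem alg_rev (w x y : ℂ) (hxy : x ≠ y) (Ax Ay Bx By : M)
    (h1 : (x - y) • (Ax * By) = ((1 - w) * x) • (Bx * Ay) + (w * x - y) • (By * Ax))
    (h2 : (y - x) • (Ay * Bx) = ((1 - w) * y) • (By * Ax) + (w * y - x) • (Bx * Ay)) :
    (w * x - y) • (Ay * Bx) + ((1 - w) * y) • (Ax * By) = (w * (x - y)) • (Bx * Ay) := by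
  have hne : x - y ≠ 0 := sub_ne_zero.mpr hxy
  have key : (x - y) • ((w * x - y) • (Ay * Bx) + ((1 - w) * y) • (Ax * By))
      = (x - y) • ((w * (x - y)) • (Bx * Ay)) := by
    linear_combination (norm := module) ((1 - w) * y) • h1 - (w * x - y) • h2
  exact (smul_right_injective M hne) key

/-- Commutation of the transfer operators from the exchange relation. -/
theorem alg_comm (w x y : ℂ) (hxy : x ≠ y) (Ax Ay Bx By : M)
    (hA : Ax * Ay = Ay * Ax) (hB : Bx * By = By * Bx)
    (h1 : (x - y) • (Ax * By) = ((1 - w) * x) • (Bx * Ay) + (w * x - y) • (By * Ax))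
    (h2 : (y - x) • (Ay * Bx) = ((1 - w) * y) • (By * Ax) + (w * y - x) • (Bx * Ay)) :
    (Ax - x • Bx) * (Ay - y • By) = (Ay - y • By) * (Ax - x • Bx) := by
  have hne : x - y ≠ 0 := sub_ne_zero.mpr hxy
  apply smul_right_injective M hne
  simp only [mul_sub, sub_mul, smul_mul_assoc, mul_smul_comm]
  rw [hA, hB]
  linear_combination (norm := module) (-y) • h1 - x • h2

/-- The exchange relation at a vertex from the one for its neighbourhood. -/
theorem alg_exch (w x y : ℂ) (hv Dx Dy Cx Cy : M)
    (hDD : Dx * Dy = Dy * Dx)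
    (hDx : Dx * hv = hv * Dx)
    (hCx : Cx * hv = w • (hv * Cx))
    (hR : (w * x - y) • (Dy * Cx) + ((1 - w) * y) • (Dx * Cy) = (w * (x - y)) • (Cx * Dy)) :
    (x - y) • ((Dx - x • Cx) * (hv * Dy)) =
      ((1 - w) * x) • ((hv * Dx) * (Dy - y • Cy)) + (w * x - y) • ((hv * Dy) * (Dx - x • Cx)) := by
  have e1 : (Dx - x • Cx) * (hv * Dy) = hv * (Dx * Dy) - (x * w) • (hv * (Cx * Dy)) := by
    rw [← mul_assoc, sub_mul, smul_mul_assoc, hCx, hDx]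
    simp only [sub_mul, smul_mul_assoc, mul_assoc, mul_smul]
  have e2 : (hv * Dx) * (Dy - y • Cy) = hv * (Dx * Dy) - y • (hv * (Dx * Cy)) := by
    simp only [mul_sub, mul_smul_comm, mul_assoc]
  have e3 : (hv * Dy) * (Dx - x • Cx) = hv * (Dx * Dy) - x • (hv * (Dy * Cx)) := by
    simp only [mul_sub, mul_smul_comm, mul_assoc, hDD]
  have hR' := congrArg (fun z => hv * z) hR
  simp only [mul_add, mul_smul_comm] at hR'
  rw [e1, e2, e3]
  linear_combination (norm := module) x • hR'

/-- Exchange relation with the simplicial mode. -/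
theorem alg_K (w x y : ℂ) (c Ax Ay Bx By : M)
    (hA : Ax * Ay = Ay * Ax) (hB : Bx * By = By * Bx)
    (hAx : Ax * c = c * Ax) (hAy : Ay * c = c * Ay)
    (hBx : Bx * c = w • (c * Bx)) (hBy : By * c = w • (c * By))
    (h1 : (x - y) • (Ax * By) = ((1 - w) * x) • (Bx * Ay) + (w * x - y) • (By * Ax))
    (hT : (Ax - x • Bx) * (Ay - y • By) = (Ay - y • By) * (Ax - x • Bx)) :
    (x - w * y) • ((Ax - x • Bx) * c * (Ay - y • By))
      + (w * x - y) • ((Ay - y • By) * c * (Ax - x • Bx)) =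
    (x - y) • ((Ax - x • Bx) * (Ay - y • By) * c + w • (c * (Ax - x • Bx) * (Ay - y • By))) := by
  have h3 : y • (Ax * By) + x • (Bx * Ay) = x • (Ay * Bx) + y • (By * Ax) := by
    simp only [mul_sub, sub_mul, smul_mul_assoc, mul_smul_comm, ← hA, ← hB] at hT
    linear_combination (norm := module) -hT
  have ex : (Ax - x • Bx) * c = c * (Ax - (w * x) • Bx) := by
    rw [sub_mul, smul_mul_assoc, hAx, hBx, mul_sub, mul_smul_comm]; module
  have ey : (Ay - y • By) * c = c * (Ay - (w * y) • By) := by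
    rw [sub_mul, smul_mul_assoc, hAy, hBy, mul_sub, mul_smul_comm]; module
  rw [mul_assoc _ _ c, ey, ← mul_assoc _ c, ex]
  have key : (x - w * y) • ((Ax - (w * x) • Bx) * (Ay - y • By))
      + (w * x - y) • ((Ay - (w * y) • By) * (Ax - x • Bx)) =
    (x - y) • ((Ax - (w * x) • Bx) * (Ay - (w * y) • By) + w • ((Ax - x • Bx) * (Ay - y • By))) := by
    simp only [mul_sub, sub_mul, smul_mul_assoc, mul_smul_comm, ← hA, ← hB]
    linear_combination (norm := module) (-((1 - w) * y)) • h1 + (w * x - y) • h3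
  have := congrArg (fun z => c * z) key
  simpa only [mul_add, mul_smul_comm, mul_assoc] using this

end Alg

section Alg2
variable {M : Type*} [Ring M] [Algebra ℂ M]

theorem alg_K2 (w x y z : ℂ) (hz : z ≠ 0) (c Tx Ty Sx : M)
    (hTS : Tx * Sx = z • 1) (hST : Sx * Tx = z • 1)
    (hTT : Tx * Ty = Ty * Tx)
    (hK : (x - w * y) • (Tx * c * Ty) + (w * x - y) • (Ty * c * Tx)
      = (x - y) • (Tx * Ty * c + w • (c * Tx * Ty))) :
    (x - w * y) • (c * (Ty * Sx)) + (w * x - y) • (Sx * Ty * c)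
      = (x - y) • (Ty * c * Sx + w • (Sx * c * Ty)) := by
  apply smul_right_injective M hz
  have e1 : Sx * (Tx * c * Ty) * Sx = z • (c * (Ty * Sx)) := by
    rw [← mul_assoc, ← mul_assoc, hST]; simp [mul_assoc]
  have e2 : Sx * (Ty * c * Tx) * Sx = z • (Sx * Ty * c) := by
    rw [mul_assoc, mul_assoc, hTS]; simp [mul_assoc]
  have e3 : Sx * (Tx * Ty * c) * Sx = z • (Ty * c * Sx) := by
    rw [← mul_assoc, ← mul_assoc, hST]; simp [mul_assoc]
  have e4 : Sx * (c * Tx * Ty) * Sx = z • (Sx * c * Ty) := by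
    rw [mul_assoc c, hTT, ← mul_assoc c, mul_assoc, mul_assoc, hTS]; simp [mul_assoc]
  have := congrArg (fun t => Sx * t * Sx) hK
  simp only [mul_add, add_mul, mul_smul_comm, smul_mul_assoc, e1, e2, e3, e4] at this
  linear_combination (norm := module) this

theorem alg_final1 (w x y : ℂ) (c Tx Ty Sx Sy : M)
    (h2 : Ty * Sy = 0)
    (hc2 : Sx * Sy = Sy * Sx)
    (hK2 : (x - w * y) • (c * (Ty * Sx)) + (w * x - y) • (Sx * Ty * c)
      = (x - y) • (Ty * c * Sx + w • (Sx * c * Ty))) :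
    (w * x - y) • ((Tx * c * Sx) * (Ty * c * Sy)) = (x - y) • (Tx * c * Ty * c * (Sx * Sy)) := by
  have := congrArg (fun t => Tx * c * t * Sy) hK2
  simp only [mul_add, add_mul, mul_smul_comm, smul_mul_assoc, mul_assoc] at this
  rw [h2, hc2, ← mul_assoc Ty Sy Sx, h2] at this
  simp only [mul_zero, zero_mul, smul_zero, add_zero, zero_add] at this
  rw [← hc2] at this
  simp only [mul_assoc]
  exact this

theorem alg_final2 (w x y : ℂ) (c Ax Ay Bx By Sx Sy : M)
    (hA : Ax * Ay = Ay * Ax) (hB : Bx * By = By * Bx)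
    (hAx : Ax * c = c * Ax) (hAy : Ay * c = c * Ay)
    (hBx : Bx * c = w • (c * Bx)) (hBy : By * c = w • (c * By))
    (hT : (Ax - x • Bx) * (Ay - y • By) = (Ay - y • By) * (Ax - x • Bx))
    (hx : (Ax - x • Bx) * Sx = 0) (hy : (Ay - y • By) * Sy = 0)
    (hc2 : Sx * Sy = Sy * Sx) :
    (Ax - x • Bx) * c * (Ay - y • By) * c * (Sx * Sy)
      = (Ay - y • By) * c * (Ax - x • Bx) * c * (Sx * Sy) := by
  have h3 : y • (Ax * By) + x • (Bx * Ay) = x • (Ay * Bx) + y • (By * Ax) := by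
    simp only [mul_sub, sub_mul, smul_mul_assoc, mul_smul_comm, ← hA, ← hB] at hT
    linear_combination (norm := module) -hT
  have ex : (Ax - x • Bx) * c = c * (Ax - (w * x) • Bx) := by
    rw [sub_mul, smul_mul_assoc, hAx, hBx, mul_sub, mul_smul_comm]; module
  have ey : (Ay - y • By) * c = c * (Ay - (w * y) • By) := by
    rw [sub_mul, smul_mul_assoc, hAy, hBy, mul_sub, mul_smul_comm]; module
  have d1 : (Ax - x • Bx) * c * (Ay - y • By) - (Ay - y • By) * c * (Ax - x • Bx)
      = (1 - w) • (c * (x • (Bx * Ay) - y • (By * Ax))) := by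
    rw [ex, ey, mul_assoc, mul_assoc, ← mul_sub, ← mul_smul_comm]
    congr 1
    simp only [mul_sub, sub_mul, smul_mul_assoc, mul_smul_comm, ← hA, ← hB]
    linear_combination (norm := module) -h3
  have d2 : (x • (Bx * Ay) - y • (By * Ax)) * c = w • (c * (x • (Bx * Ay) - y • (By * Ax))) := by
    rw [sub_mul, smul_mul_assoc, smul_mul_assoc, mul_assoc, mul_assoc, hAx, hAy, ← mul_assoc,
      ← mul_assoc, hBx, hBy]
    simp only [mul_sub, smul_mul_assoc, mul_smul_comm, mul_assoc]
    module
  have d3 : x • (Bx * Ay) - y • (By * Ax)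
      = x • (Bx * (Ay - y • By)) - y • (By * (Ax - x • Bx)) := by
    simp only [mul_sub, mul_smul_comm, hB]
    module
  have d4 : (x • (Bx * Ay) - y • (By * Ax)) * (Sx * Sy) = 0 := by
    rw [d3, sub_mul, smul_mul_assoc, smul_mul_assoc, mul_assoc By, ← mul_assoc (Ax - x • Bx) Sx, hx,
      hc2, mul_assoc Bx, ← mul_assoc (Ay - y • By) Sy, hy]
    simp
  rw [← sub_eq_zero, ← sub_mul, ← sub_mul, d1, smul_mul_assoc, smul_mul_assoc, mul_assoc c, d2,
    mul_smul_comm, smul_mul_assoc, mul_assoc c, mul_assoc c, d4]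
  simp

/-- Product of `F (n-1) * … * F 0`. -/
def dprod (F : ℕ → M) : ℕ → M
  | 0 => 1
  | n + 1 => F n * dprod F n

theorem dprod_commute (F : ℕ → M) (X : M) (hX : ∀ m, X * F m = F m * X) (n : ℕ) :
    X * dprod F n = dprod F n * X := by
  induction n with
  | zero => simp [dprod]
  | succ n ih => simp only [dprod]; rw [← mul_assoc, hX, mul_assoc, ih, mul_assoc]

theorem dprod_eq_list (F : ℕ → M) (hF : ∀ m n, F m * F n = F n * F m) (n : ℕ) :
    ((List.range n).map F).prod = dprod F n := by
  induction n with
  | zero => simp [dprod]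
  | succ n ih =>
    rw [List.range_succ, List.map_append, List.prod_append, ih]
    simp [dprod, dprod_commute F (F n) (hF n)]

theorem dprod_mul (X : M) (F : ℕ → M) (hX : ∀ m, X * F m = F m * X) (n : ℕ) :
    dprod (fun m => X * F m) n = X ^ n * dprod F n := by
  induction n with
  | zero => simp [dprod]
  | succ n ih =>
    simp only [dprod, ih]
    have : Commute (F n) (X ^ n) := Commute.pow_right (hX n).symm n
    rw [pow_succ', mul_assoc, ← mul_assoc (F n), this.eq]
    simp [mul_assoc]

/-- Words with `j` letters `A` on the right. -/
def wordW (A B : ℕ → M) : ℕ → ℕ → M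
  | 0, _ => 1
  | n + 1, j => if j ≤ n then B n * wordW A B n j else A n * wordW A B n n

theorem wordW_A (A B : ℕ → M) (hrel : ∀ n, A (n + 1) * B n = B (n + 1) * A n) (n : ℕ) :
    ∀ j ≤ n, A n * wordW A B n j = wordW A B (n + 1) (j + 1) := by
  induction n with
  | zero => intro j hj; simp [wordW, Nat.le_zero.mp hj]
  | succ n ih =>
    intro j hj
    rcases Nat.lt_or_ge n j with h1 | h1
    · have : j = n + 1 := by omega
      subst this
      conv_rhs => rw [wordW]
      simp
    · conv_lhs => rw [wordW]
      rw [if_pos h1, ← mul_assoc, hrel, mul_assoc, ih j h1]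
      conv_rhs => rw [wordW]
      rw [if_pos (by omega)]

theorem wordW_B (A B : ℕ → M) (n j : ℕ) (hj : j ≤ n) :
    B n * wordW A B n j = wordW A B (n + 1) j := by
  conv_rhs => rw [wordW]
  rw [if_pos hj]

theorem wordW_zero (A B : ℕ → M) (n : ℕ) : wordW A B n 0 = dprod B n := by
  induction n with
  | zero => simp [wordW, dprod]
  | succ n ih => simp [wordW, dprod, ih]

theorem wordW_diag (A B : ℕ → M) (n : ℕ) : wordW A B n n = dprod A n := by
  induction n with
  | zero => simp [wordW, dprod]
  | succ n ih => simp [wordW, dprod, ih]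

open Polynomial in
theorem dprod_expand (A B : ℕ → M) (a : ℕ → ℂ)
    (hrel : ∀ n, A (n + 1) * B n = B (n + 1) * A n) (n : ℕ) :
    dprod (fun m => A m - a m • B m) n =
      ∑ j ∈ Finset.range (n + 1),
        (∏ i ∈ Finset.range n, ((X : ℂ[X]) - C (a i))).coeff j • wordW A B n j := by
  induction n with
  | zero => simp [dprod, wordW]
  | succ n ih =>
    simp only [dprod]
    rw [ih, Finset.prod_range_succ]
    set c : ℂ[X] := ∏ i ∈ Finset.range n, ((X : ℂ[X]) - C (a i)) with hc
    have hdeg : c.coeff (n + 1) = 0 := by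
      apply coeff_eq_zero_of_natDegree_lt
      rw [hc, natDegree_finsetProd_X_sub_C_eq_card]
      simp
    rw [Finset.sum_range_succ' _ (n + 1)]
    simp only [coeff_mul_X_sub_C, mul_coeff_zero, coeff_sub, coeff_X_zero, coeff_C_zero, zero_sub]
    have s1 : ∑ j ∈ Finset.range (n + 1), (c.coeff (j + 1) * a n) • wordW A B (n + 1) (j + 1)
        + (c.coeff 0 * a n) • wordW A B (n + 1) 0
        = ∑ j ∈ Finset.range (n + 1), (c.coeff j * a n) • wordW A B (n + 1) j := by
      rw [← Finset.sum_range_succ' (fun j => (c.coeff j * a n) • wordW A B (n + 1) j),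
        Finset.sum_range_succ, hdeg]
      simp
    have s2 : A n * ∑ j ∈ Finset.range (n + 1), c.coeff j • wordW A B n j
        = ∑ j ∈ Finset.range (n + 1), c.coeff j • wordW A B (n + 1) (j + 1) := by
      rw [Finset.mul_sum]
      refine Finset.sum_congr rfl fun j hj => ?_
      rw [mul_smul_comm, wordW_A A B hrel n j (by simp at hj; omega)]
    have s3 : B n * ∑ j ∈ Finset.range (n + 1), c.coeff j • wordW A B n j
        = ∑ j ∈ Finset.range (n + 1), c.coeff j • wordW A B (n + 1) j := by
      rw [Finset.mul_sum]
      refine Finset.sum_congr rfl fun j hj => ?_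
      rw [mul_smul_comm, wordW_B A B n j (by simp at hj; omega)]
    have s4 : a n • ∑ j ∈ Finset.range (n + 1), c.coeff j • wordW A B (n + 1) j
        = ∑ j ∈ Finset.range (n + 1), (c.coeff j * a n) • wordW A B (n + 1) j := by
      rw [Finset.smul_sum]
      refine Finset.sum_congr rfl fun j _ => ?_
      rw [smul_smul, mul_comm]
    rw [sub_mul, smul_mul_assoc, s2, s3, s4, ← s1]
    simp only [sub_smul, Finset.sum_sub_distrib, mul_neg, neg_smul]
    abel

open Polynomial in
theorem dprod_root (A B : ℕ → M) (d : ℕ) (hd : 0 < d) (ζ x : ℂ) (hζ : IsPrimitiveRoot ζ d)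
    (hrel : ∀ n, A (n + 1) * B n = B (n + 1) * A n) :
    dprod (fun m => A m - (ζ ^ m * x) • B m) d = dprod A d - x ^ d • dprod B d := by
  rw [dprod_expand A B (fun m => ζ ^ m * x) hrel, ← X_pow_sub_C_eq_prod hζ hd rfl,
    Finset.sum_range_succ, wordW_diag]
  obtain ⟨e, rfl⟩ : ∃ e, d = e + 1 := ⟨d - 1, by omega⟩
  rw [Finset.sum_range_succ', wordW_zero, Finset.sum_eq_zero]
  · simp [coeff_X_pow, coeff_C, -map_pow]
    abel
  · intro j hj
    simp only [Finset.mem_range] at hj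
    have h1 : j ≠ e := by omega
    simp [coeff_X_pow, coeff_C, h1, -map_pow]

end Alg2

section Graph
variable {V : Type*} [LinearOrder V] {N : ℕ}

/-- The vertices of `A` different from and not adjacent to `v`. -/
def nonNb (G : SimpleGraph V) (A : Finset V) (v : V) : Finset V :=
  A.filter (fun u => u ≠ v ∧ ¬ G.Adj u v)

theorem mem_nonNb {G : SimpleGraph V} {A : Finset V} {v u : V} :
    u ∈ nonNb G A v ↔ u ∈ A ∧ u ≠ v ∧ ¬ G.Adj u v := by
  simp [nonNb]

/-- The transfer operator as a sum over independent sets. -/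
def tOp (G : SimpleGraph V) (h : V → Matrix (Fin N) (Fin N) ℂ) (A : Finset V) (x : ℂ) :
    Matrix (Fin N) (Fin N) ℂ :=
  ∑ S ∈ A.powerset.filter (fun S => IsIndep G S), (-x) ^ S.card • hProd h S

theorem transferT_eq (G : SimpleGraph V) (h : V → Matrix (Fin N) (Fin N) ℂ) (A : Finset V) (x : ℂ) :
    transferT G h A x = tOp G h A x := by
  unfold transferT tOp chargeQ
  rw [← Finset.sum_fiberwise_of_maps_to (s := A.powerset.filter (fun S => IsIndep G S))
    (t := Finset.range (indepNum G A + 1)) (g := Finset.card)]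
  · refine Finset.sum_congr rfl fun k _ => ?_
    rw [Finset.smul_sum, Finset.filter_filter]
    refine Finset.sum_congr rfl fun S hS => ?_
    simp only [Finset.mem_filter] at hS
    rw [hS.2.2]
  · intro S hS
    rw [Finset.mem_range, Nat.lt_succ_iff]
    exact Finset.le_sup (f := Finset.card) hS

theorem sum_indep_split {E : Type*} [AddCommMonoid E] (G : SimpleGraph V) (A : Finset V) (v : V)
    (hv : v ∈ A) (g : Finset V → E) :
    ∑ S ∈ A.powerset.filter (fun S => IsIndep G S), g S =
      ∑ S ∈ (A.erase v).powerset.filter (fun S => IsIndep G S), g S +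
      ∑ S ∈ (nonNb G A v).powerset.filter (fun S => IsIndep G S), g (insert v S) := by
  rw [← Finset.sum_filter_add_sum_filter_not _ (fun S => v ∉ S)]
  congr 1
  · apply Finset.sum_congr _ (fun _ _ => rfl)
    ext S
    simp only [Finset.mem_filter, Finset.mem_powerset]
    constructor
    · rintro ⟨⟨h1, h2⟩, h3⟩
      exact ⟨fun u hu => Finset.mem_erase.mpr ⟨fun e => h3 (e ▸ hu), h1 hu⟩, h2⟩
    · rintro ⟨h1, h2⟩
      exact ⟨⟨h1.trans (Finset.erase_subset _ _), h2⟩,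
        fun hv' => (Finset.mem_erase.mp (h1 hv')).1 rfl⟩
  · symm
    refine Finset.sum_bij' (fun S _ => insert v S) (fun S _ => S.erase v) ?_ ?_ ?_ ?_ ?_
    · intro S hS
      simp only [Finset.mem_filter, Finset.mem_powerset, not_not] at hS ⊢
      refine ⟨⟨?_, ?_⟩, Finset.mem_insert_self _ _⟩
      · intro u hu
        rcases Finset.mem_insert.mp hu with rfl | hu
        · exact hv
        · exact (mem_nonNb.mp (hS.1 hu)).1
      · intro u hu w hw huw
        rcases Finset.mem_insert.mp hu with rfl | hu' <;> rcases Finset.mem_insert.mp hw with rfl | hw'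
        · exact absurd rfl huw
        · exact fun hadj => (mem_nonNb.mp (hS.1 hw')).2.2 hadj.symm
        · exact (mem_nonNb.mp (hS.1 hu')).2.2
        · exact hS.2 u hu' w hw' huw
    · intro S hS
      simp only [Finset.mem_filter, Finset.mem_powerset, not_not] at hS ⊢
      refine ⟨?_, ?_⟩
      · intro u hu
        have hu' := Finset.mem_erase.mp hu
        exact mem_nonNb.mpr ⟨hS.1.1 hu'.2, hu'.1, hS.1.2 u hu'.2 v hS.2 hu'.1⟩
      · intro u hu w hw huw
        exact hS.1.2 u (Finset.mem_of_mem_erase hu) w (Finset.mem_of_mem_erase hw) huw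
    · intro S hS
      simp only [Finset.mem_filter, Finset.mem_powerset] at hS
      exact Finset.erase_insert (fun hv' => (mem_nonNb.mp (hS.1 hv')).2.1 rfl)
    · intro S hS
      simp only [Finset.mem_filter, Finset.mem_powerset, not_not] at hS
      exact Finset.insert_erase hS.2
    · intro S hS
      rfl

theorem hProd_insert (G : SimpleGraph V) (h : V → Matrix (Fin N) (Fin N) ℂ)
    (hcn : ∀ u w, u ≠ w → ¬ G.Adj u w → h u * h w = h w * h u)
    (S : Finset V) (v : V) (hv : v ∉ S) (hS : IsIndep G (insert v S)) :
    hProd h (insert v S) = h v * hProd h S := by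
  unfold hProd
  have hp : ((insert v S).sort (· ≤ ·)).Perm (v :: S.sort (· ≤ ·)) := by
    rw [← Multiset.coe_eq_coe, Finset.sort_eq, Finset.insert_val_of_notMem hv, ← Multiset.cons_coe,
      Finset.sort_eq]
  have hp' := hp.map h
  rw [List.Perm.prod_eq' hp']
  · simp
  · rw [List.pairwise_map]
    have hnd : ((insert v S).sort (· ≤ ·)).Nodup := Finset.sort_nodup _ _
    refine List.Pairwise.imp_of_mem ?_ hnd
    intro a b ha hb hab
    rw [Finset.mem_sort] at ha hb
    exact hcn a b hab (hS a ha b hb hab)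

theorem tOp_rec (G : SimpleGraph V) (h : V → Matrix (Fin N) (Fin N) ℂ)
    (hcn : ∀ u w, u ≠ w → ¬ G.Adj u w → h u * h w = h w * h u)
    (A : Finset V) (v : V) (hv : v ∈ A) (x : ℂ) :
    tOp G h A x = tOp G h (A.erase v) x - x • (h v * tOp G h (nonNb G A v) x) := by
  unfold tOp
  rw [sum_indep_split G A v hv, sub_eq_add_neg, ← neg_smul, Finset.mul_sum, Finset.smul_sum]
  congr 1
  refine Finset.sum_congr rfl fun S hS => ?_
  simp only [Finset.mem_filter, Finset.mem_powerset] at hS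
  have hvS : v ∉ S := fun hv' => (mem_nonNb.mp (hS.1 hv')).2.1 rfl
  rw [hProd_insert G h hcn S v hvS, Finset.card_insert_of_notMem hvS, mul_smul_comm, smul_smul,
    pow_succ']
  intro u hu w hw huw
  rcases Finset.mem_insert.mp hu with rfl | hu' <;> rcases Finset.mem_insert.mp hw with rfl | hw'
  · exact absurd rfl huw
  · exact fun hadj => (mem_nonNb.mp (hS.1 hw')).2.2 hadj.symm
  · exact (mem_nonNb.mp (hS.1 hu')).2.2
  · exact hS.2 u hu' w hw' huw

theorem indepPoly_rec (G : SimpleGraph V) (w : V → ℂ) (A : Finset V) (v : V) (hv : v ∈ A) (x : ℂ) :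
    indepPoly G w A x = indepPoly G w (A.erase v) x + x * w v * indepPoly G w (nonNb G A v) x := by
  unfold indepPoly
  rw [sum_indep_split G A v hv, Finset.mul_sum]
  congr 1
  refine Finset.sum_congr rfl fun S hS => ?_
  simp only [Finset.mem_filter, Finset.mem_powerset] at hS
  have hvS : v ∉ S := fun hv' => (mem_nonNb.mp (hS.1 hv')).2.1 rfl
  rw [Finset.prod_insert hvS]

theorem filter_indep_empty (G : SimpleGraph V) :
    (∅ : Finset V).powerset.filter (fun S => IsIndep G S) = {∅} := by
  ext S
  simp only [Finset.mem_filter, Finset.mem_powerset, Finset.subset_empty, Finset.mem_singleton]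
  constructor
  · exact fun hS => hS.1
  · rintro rfl
    exact ⟨rfl, fun u hu => absurd hu (Finset.notMem_empty u)⟩

theorem tOp_empty (G : SimpleGraph V) (h : V → Matrix (Fin N) (Fin N) ℂ) (x : ℂ) :
    tOp G h ∅ x = 1 := by
  unfold tOp
  rw [filter_indep_empty]
  simp [hProd]

theorem indepPoly_empty (G : SimpleGraph V) (w : V → ℂ) (x : ℂ) :
    indepPoly G w ∅ x = 1 := by
  unfold indepPoly
  rw [filter_indep_empty]
  simp

theorem nonNb_subset (G : SimpleGraph V) (A : Finset V) (v : V) : nonNb G A v ⊆ A.erase v :=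
  fun _ hu => Finset.mem_erase.mpr ⟨(mem_nonNb.mp hu).2.1, (mem_nonNb.mp hu).1⟩

/-- An operator commuting with all local terms commutes with the transfer operator. -/
theorem tOp_commute (G : SimpleGraph V) (h : V → Matrix (Fin N) (Fin N) ℂ)
    (X : Matrix (Fin N) (Fin N) ℂ) (A : Finset V) (hX : ∀ u ∈ A, h u * X = X * h u) (x : ℂ) :
    tOp G h A x * X = X * tOp G h A x := by
  unfold tOp
  rw [Finset.sum_mul, Finset.mul_sum]
  refine Finset.sum_congr rfl fun S hS => ?_
  simp only [Finset.mem_filter, Finset.mem_powerset] at hS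
  rw [smul_mul_assoc, mul_smul_comm]
  congr 1
  unfold hProd
  have : Commute X ((S.sort (· ≤ ·)).map h).prod := by
    apply Commute.list_prod_right
    intro a ha
    obtain ⟨u, hu, rfl⟩ := List.mem_map.mp ha
    rw [Finset.mem_sort] at hu
    exact (hX u (hS.1 hu)).symm
  exact this.symm

/-- Expansion of the transfer operator along a clique. -/
theorem tOp_clique (G : SimpleGraph V) (h : V → Matrix (Fin N) (Fin N) ℂ)
    (hcn : ∀ u w, u ≠ w → ¬ G.Adj u w → h u * h w = h w * h u)
    (x : ℂ) (K : Finset V) : ∀ A : Finset V, K ⊆ A →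
    (∀ u ∈ K, ∀ w ∈ K, u ≠ w → G.Adj u w) →
    tOp G h A x = tOp G h (A \ K) x - x • ∑ u ∈ K, h u * tOp G h (nonNb G (A \ K) u) x := by
  induction K using Finset.induction_on with
  | empty => intro A _ _; simp
  | insert u K hu ih =>
    intro A hKA hK
    have huA : u ∈ A := hKA (Finset.mem_insert_self _ _)
    rw [tOp_rec G h hcn A u huA, ih (A.erase u)
      (fun w hw => Finset.mem_erase.mpr ⟨fun e => hu (e ▸ hw), hKA (Finset.mem_insert_of_mem hw)⟩)
      (fun a ha b hb => hK a (Finset.mem_insert_of_mem ha) b (Finset.mem_insert_of_mem hb)),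
      Finset.sum_insert hu]
    have e1 : A.erase u \ K = A \ insert u K := by
      ext w; simp only [Finset.mem_sdiff, Finset.mem_erase, Finset.mem_insert]; tauto
    have e2 : nonNb G A u = nonNb G (A \ insert u K) u := by
      ext w
      simp only [mem_nonNb, Finset.mem_sdiff, Finset.mem_insert]
      constructor
      · rintro ⟨h1, h2, h3⟩
        refine ⟨⟨h1, ?_⟩, h2, h3⟩
        rintro (h4 | h4)
        · exact h2 h4
        · exact h3 (hK w (Finset.mem_insert_of_mem h4) u (Finset.mem_insert_self _ _) h2)
      · rintro ⟨h1, h2, h3⟩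
        exact ⟨h1.1, h2, h3⟩
    rw [e1, e2, smul_add]
    abel

end Graph

section Main
variable {V : Type*} [LinearOrder V] {N : ℕ}

theorem hBcomm {M : Type*} [Ring M] (hv Dx Dy : M) (h1 : Dx * hv = hv * Dx) (h2 : Dy * hv = hv * Dy)
    (h3 : Dx * Dy = Dy * Dx) : hv * Dx * (hv * Dy) = hv * Dy * (hv * Dx) := by
  rw [mul_assoc, ← mul_assoc Dx, h1, mul_assoc hv Dx, h3, mul_assoc hv Dy, ← mul_assoc Dy hv, h2,
    mul_assoc hv Dy]

theorem tOp_exchange (ω : ℂ) (G : SimpleGraph V) (dir : V → V → Prop)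
    (hirr : ∀ u, ¬ dir u u)
    (hor : ∀ u v, G.Adj u v → dir u v ∨ dir v u)
    (hin : ∀ v u w, dir u v → dir w v → u ≠ w → G.Adj u w)
    (hout : ∀ u v w, dir u v → dir u w → v ≠ w → G.Adj v w)
    (hsink : ∀ A : Finset V, A.Nonempty → ∃ v ∈ A, ∀ u ∈ A, ¬ dir v u)
    (h : V → Matrix (Fin N) (Fin N) ℂ)
    (hcd : ∀ u w, dir u w → h u * h w = ω • (h w * h u))
    (hcn : ∀ u w, u ≠ w → ¬ G.Adj u w → h u * h w = h w * h u) (n : ℕ) :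
    ∀ A : Finset V, A.card ≤ n →
      (∀ x y, tOp G h A x * tOp G h A y = tOp G h A y * tOp G h A x) ∧
      (∀ v ∈ A, (∀ u ∈ A, ¬ dir v u) → ∀ x y : ℂ,
        (x - y) • (tOp G h (A.erase v) x * (h v * tOp G h (nonNb G A v) y)) =
          ((1 - ω) * x) • ((h v * tOp G h (nonNb G A v) x) * tOp G h (A.erase v) y) +
          (ω * x - y) • ((h v * tOp G h (nonNb G A v) y) * tOp G h (A.erase v) x)) := by
  induction n with
  | zero =>
    intro A hA
    have : A = ∅ := Finset.card_eq_zero.mp (by omega)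
    subst this
    refine ⟨fun x y => by simp [tOp_empty], fun v hv => absurd hv (Finset.notMem_empty v)⟩
  | succ n ih =>
    intro A hA
    have hR : ∀ v ∈ A, (∀ u ∈ A, ¬ dir v u) → ∀ x y : ℂ,
        (x - y) • (tOp G h (A.erase v) x * (h v * tOp G h (nonNb G A v) y)) =
          ((1 - ω) * x) • ((h v * tOp G h (nonNb G A v) x) * tOp G h (A.erase v) y) +
          (ω * x - y) • ((h v * tOp G h (nonNb G A v) y) * tOp G h (A.erase v) x) := by
      intro v hv hvs x y
      by_cases hxy : x = y
      · subst hxy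
        module
      set K : Finset V := (A.erase v).filter (fun u => G.Adj u v) with hKdef
      have hKmem : ∀ u ∈ K, u ∈ A ∧ u ≠ v ∧ G.Adj u v ∧ dir u v := by
        intro u hu
        rw [hKdef, Finset.mem_filter, Finset.mem_erase] at hu
        refine ⟨hu.1.2, hu.1.1, hu.2, ?_⟩
        exact (hor u v hu.2).resolve_right (hvs u hu.1.2)
      have hKA : K ⊆ A.erase v := Finset.filter_subset _ _
      have hKc : ∀ u ∈ K, ∀ w ∈ K, u ≠ w → G.Adj u w := fun u hu w hw =>
        hin v u w (hKmem u hu).2.2.2 (hKmem w hw).2.2.2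
      have hD : A.erase v \ K = nonNb G A v := by
        ext u
        simp only [hKdef, mem_nonNb, Finset.mem_sdiff, Finset.mem_filter, Finset.mem_erase]
        tauto
      have hexp : ∀ t : ℂ, tOp G h (A.erase v) t = tOp G h (nonNb G A v) t
          - t • ∑ u ∈ K, h u * tOp G h (nonNb G (nonNb G A v) u) t := by
        intro t
        rw [tOp_clique G h hcn t K _ hKA hKc, hD]
      have hcard : (A.erase v).card ≤ n := by
        rw [Finset.card_erase_of_mem hv]; omega
      rw [hexp x, hexp y]
      have hDh : ∀ u ∈ nonNb G A v, h u * h v = h v * h u := fun u hu =>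
        hcn u v (mem_nonNb.mp hu).2.1 (mem_nonNb.mp hu).2.2
      apply alg_exch
      · exact (ih _ ((Finset.card_le_card (nonNb_subset G A v)).trans hcard)).1 x y
      · exact tOp_commute G h (h v) _ hDh x
      · rw [Finset.sum_mul, Finset.mul_sum, Finset.smul_sum]
        refine Finset.sum_congr rfl fun u hu => ?_
        rw [mul_assoc, tOp_commute G h (h v) _
          (fun w hw => hDh w (mem_nonNb.mp hw).1) x, ← mul_assoc, hcd u v (hKmem u hu).2.2.2]
        simp [mul_assoc]
      · simp only [Finset.mul_sum, Finset.sum_mul, Finset.smul_sum]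
        rw [← Finset.sum_add_distrib]
        refine Finset.sum_congr rfl fun u hu => ?_
        have hu' := hKmem u hu
        have huD : u ∉ nonNb G A v := fun hm => (mem_nonNb.mp hm).2.2 hu'.2.2.1
        have hsub : insert u (nonNb G A v) ⊆ A.erase v :=
          Finset.insert_subset (Finset.mem_erase.mpr ⟨hu'.2.1, hu'.1⟩) (nonNb_subset G A v)
        have hRu := (ih _ ((Finset.card_le_card hsub).trans hcard)).2 u (Finset.mem_insert_self _ _)
          (by
            intro w hw hdw
            rcases Finset.mem_insert.mp hw with rfl | hw
            · exact hirr w hdw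
            · exact (mem_nonNb.mp hw).2.2
                (hout u w v hdw hu'.2.2.2 (mem_nonNb.mp hw).2.1))
        have hE : (insert u (nonNb G A v)).erase u = nonNb G A v := Finset.erase_insert huD
        have hN : nonNb G (insert u (nonNb G A v)) u = nonNb G (nonNb G A v) u := by
          ext w
          simp only [mem_nonNb, Finset.mem_insert]
          tauto
        rw [hE, hN] at hRu
        exact alg_rev ω x y hxy _ _ _ _ (hRu x y) (hRu y x)
    refine ⟨?_, hR⟩
    intro x y
    by_cases hxy : x = y
    · rw [hxy]
    rcases A.eq_empty_or_nonempty with rfl | hne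
    · simp [tOp_empty]
    obtain ⟨v, hv, hvs⟩ := hsink A hne
    have hcard : (A.erase v).card ≤ n := by
      rw [Finset.card_erase_of_mem hv]; omega
    rw [tOp_rec G h hcn A v hv x, tOp_rec G h hcn A v hv y]
    have hDh : ∀ u ∈ nonNb G A v, h u * h v = h v * h u := fun u hu =>
      hcn u v (mem_nonNb.mp hu).2.1 (mem_nonNb.mp hu).2.2
    apply alg_comm ω x y hxy
    · exact (ih _ hcard).1 x y
    · exact hBcomm _ _ _ (tOp_commute G h (h v) _ hDh x) (tOp_commute G h (h v) _ hDh y)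
        ((ih _ ((Finset.card_le_card (nonNb_subset G A v)).trans hcard)).1 x y)
    · exact hR v hv hvs x y
    · exact hR v hv hvs y x

end Main

section Final
variable {V : Type*} [LinearOrder V] {N : ℕ}

theorem tOp_dprod (d : ℕ) (hd : 2 ≤ d) (ω : ℂ) (hω : IsPrimitiveRoot ω d)
    (G : SimpleGraph V) (dir : V → V → Prop)
    (hsink : ∀ A : Finset V, A.Nonempty → ∃ v ∈ A, ∀ u ∈ A, ¬ dir v u)
    (h : V → Matrix (Fin N) (Fin N) ℂ) (w : V → ℂ)
    (hpow : ∀ v, h v ^ d = w v • (1 : Matrix (Fin N) (Fin N) ℂ))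
    (hcn : ∀ u w, u ≠ w → ¬ G.Adj u w → h u * h w = h w * h u)
    (hexch : ∀ (A : Finset V), ∀ v ∈ A, (∀ u ∈ A, ¬ dir v u) → ∀ x y : ℂ,
        (x - y) • (tOp G h (A.erase v) x * (h v * tOp G h (nonNb G A v) y)) =
          ((1 - ω) * x) • ((h v * tOp G h (nonNb G A v) x) * tOp G h (A.erase v) y) +
          (ω * x - y) • ((h v * tOp G h (nonNb G A v) y) * tOp G h (A.erase v) x))
    (x : ℂ) (hx : x ≠ 0) (n : ℕ) :
    ∀ A : Finset V, A.card ≤ n →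
      dprod (fun m => tOp G h A (ω⁻¹ ^ m * x)) d
        = indepPoly G w A (-(x ^ d)) • (1 : Matrix (Fin N) (Fin N) ℂ) := by
  have hemp : ∀ k, dprod (fun _ => (1 : Matrix (Fin N) (Fin N) ℂ)) k = 1 := by
    intro k
    induction k with
    | zero => rfl
    | succ k ih => simp [dprod, ih]
  have hω0 : ω ≠ 0 := hω.ne_zero (by omega)
  have hω1 : ω ≠ 1 := hω.ne_one (by omega)
  induction n with
  | zero =>
    intro A hA
    have : A = ∅ := Finset.card_eq_zero.mp (by omega)
    subst this
    simp only [tOp_empty, indepPoly_empty, hemp, one_smul]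
  | succ n ih =>
    intro A hA
    rcases A.eq_empty_or_nonempty with rfl | hne
    · simp only [tOp_empty, indepPoly_empty, hemp, one_smul]
    obtain ⟨v, hv, hvs⟩ := hsink A hne
    have hcard : (A.erase v).card ≤ n := by
      rw [Finset.card_erase_of_mem hv]; omega
    have hDh : ∀ u ∈ nonNb G A v, h u * h v = h v * h u := fun u hu =>
      hcn u v (mem_nonNb.mp hu).2.1 (mem_nonNb.mp hu).2.2
    have e1 : (fun m => tOp G h A (ω⁻¹ ^ m * x)) =
        fun m => tOp G h (A.erase v) (ω⁻¹ ^ m * x)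
          - (ω⁻¹ ^ m * x) • (h v * tOp G h (nonNb G A v) (ω⁻¹ ^ m * x)) := by
      funext m
      exact tOp_rec G h hcn A v hv _
    rw [e1, dprod_root (fun m => tOp G h (A.erase v) (ω⁻¹ ^ m * x))
      (fun m => h v * tOp G h (nonNb G A v) (ω⁻¹ ^ m * x)) d (by omega) ω⁻¹ x hω.inv,
      ih _ hcard, dprod_mul (h v) (fun m => tOp G h (nonNb G A v) (ω⁻¹ ^ m * x))
      (fun m => (tOp_commute G h (h v) _ hDh _).symm), hpow,
      ih _ ((Finset.card_le_card (nonNb_subset G A v)).trans hcard), indepPoly_rec G w A v hv]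
    · simp only [smul_mul_assoc, one_mul]
      module
    · intro m
      have h1 := hexch A v hv hvs (ω⁻¹ ^ (m + 1) * x) (ω⁻¹ ^ m * x)
      have h2 : ω * (ω⁻¹ ^ (m + 1) * x) = ω⁻¹ ^ m * x := by
        rw [pow_succ]; field_simp
      rw [h2, sub_self, zero_smul, add_zero] at h1
      have h3 : ω⁻¹ ^ (m + 1) * x - ω⁻¹ ^ m * x = (1 - ω) * (ω⁻¹ ^ (m + 1) * x) := by
        rw [sub_mul, h2, one_mul]
      rw [h3] at h1
      refine smul_right_injective _ ?_ h1
      exact mul_ne_zero (sub_ne_zero.mpr (Ne.symm hω1))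
        (mul_ne_zero (pow_ne_zero _ (inv_ne_zero hω0)) hx)

theorem list_prod_mul_zero {M : Type*} [Ring M] (s a : M) (l : List M)
    (hs : ∀ b ∈ l, b * s = s * b) (ha : a ∈ l) (h0 : a * s = 0) : l.prod * s = 0 := by
  induction l with
  | nil => exact absurd ha List.not_mem_nil
  | cons b l ih =>
    rw [List.prod_cons, mul_assoc]
    rcases List.mem_cons.mp ha with rfl | ha
    · have hc : Commute s l.prod := Commute.list_prod_right _ _
        (fun c hc => (hs c (List.mem_cons_of_mem _ hc)).symm)
      rw [← hc.eq, ← mul_assoc, h0, zero_mul]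
    · rw [ih (fun c hc => hs c (List.mem_cons_of_mem _ hc)) ha, mul_zero]

theorem tOp_continuous (G : SimpleGraph V) (h : V → Matrix (Fin N) (Fin N) ℂ) (A : Finset V) :
    Continuous (fun x => tOp G h A x) := by
  unfold tOp
  fun_prop

theorem tsucc_shift (d : ℕ) (G : SimpleGraph V) (h : V → Matrix (Fin N) (Fin N) ℂ) (A : Finset V)
    (hd : 2 ≤ d) (p : ℤ) (u : ℂ) :
    transferTsucc d G h A p u = transferTsucc d G h A 0 (u * omegaD d ^ (-p)) := by
  have hω0 : omegaD d ≠ 0 := Complex.exp_ne_zero _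
  unfold transferTsucc
  congr 1
  refine List.map_congr_left fun m _ => ?_
  rw [mul_assoc, ← zpow_add₀ hω0]
  congr 3
  ring

theorem tsucc_continuous (d : ℕ) (G : SimpleGraph V) (h : V → Matrix (Fin N) (Fin N) ℂ)
    (A : Finset V) : Continuous (fun x => transferTsucc d G h A 0 x) := by
  unfold transferTsucc
  refine continuous_list_prod _ fun m _ => ?_
  simp only [transferT_eq]
  exact (tOp_continuous G h A).comp (by fun_prop)

theorem tsucc_eq (d : ℕ) (G : SimpleGraph V) (h : V → Matrix (Fin N) (Fin N) ℂ) (A : Finset V)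
    (p : ℤ) (u : ℂ) :
    transferTsucc d G h A p u = ((List.range (d - 1)).map
      (fun m : ℕ => transferT G h A (u * omegaD d ^ (-(p + (m : ℤ) + 1))))).prod := by
  unfold transferTsucc
  congr 1
  simp only [List.bind_eq_flatMap, List.pure_def, List.map_flatMap, List.map_cons, List.map_nil]
  exact List.map_eq_flatMap.symm

open Polynomial in
theorem dense_good (d : ℕ) (hd : 2 ≤ d) (G : SimpleGraph V) (w : V → ℂ) (A : Finset V) :
    Dense {x : ℂ | x ≠ 0 ∧ indepPoly G w A (-(x ^ d)) ≠ 0} := by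
  set P : ℂ[X] := ∑ S ∈ A.powerset.filter (fun S => IsIndep G S), ∏ u ∈ S, (-(X ^ d) * C (w u))
    with hP
  have hev : ∀ x, P.eval x = indepPoly G w A (-(x ^ d)) := by
    intro x
    simp only [hP, indepPoly, eval_finsetSum, eval_prod, eval_mul, eval_neg, eval_pow, eval_X, eval_C]
  have hP0 : P ≠ 0 := by
    intro h0
    have h1 := hev 0
    rw [h0, eval_zero, zero_pow (by omega), neg_zero] at h1
    have : indepPoly G w A 0 = 1 := by
      unfold indepPoly
      rw [Finset.sum_eq_single ∅]
      · simp
      · intro S _ hS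
        obtain ⟨u, hu⟩ := Finset.nonempty_iff_ne_empty.mpr hS
        exact Finset.prod_eq_zero hu (by simp)
      · intro hn
        exfalso
        apply hn
        simp only [Finset.mem_filter, Finset.mem_powerset, Finset.empty_subset, true_and]
        exact fun u hu => absurd hu (Finset.notMem_empty u)
    rw [this] at h1
    exact zero_ne_one h1
  have hfin := Polynomial.finite_setOfPred_isRoot (mul_ne_zero (X_ne_zero (R := ℂ)) hP0)
  have hset : {x : ℂ | x ≠ 0 ∧ indepPoly G w A (-(x ^ d)) ≠ 0} = {x | IsRoot (X * P) x}ᶜ := by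
    ext x
    simp [IsRoot, hev]
  rw [hset]
  exact Set.Countable.dense_compl ℂ hfin.countable

end Final
/-- exchange algebra of the parafermionic modes. -/
theorem paraMode_commutator
    {V : Type*} [Fintype V] [LinearOrder V] {N : ℕ}
    (d : ℕ) (hd : 2 ≤ d)
    (G : SimpleGraph V) (dir : V → V → Prop)
    (hdir : ∀ u v, dir u v → G.Adj u v)
    (hdir' : ∀ u v, G.Adj u v → (dir u v ↔ ¬ dir v u))
    (hdip : DipathOriented G dir)
    (f : V → ℕ) (hopeo : IsOPEO G dir f)
    (v : V) (hlast : ∀ u, u ≠ v → f u < f v)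
    (h : V → Matrix (Fin N) (Fin N) ℂ) (b : V → ℝ)
    (hb : ∀ w, b w ≠ 0)
    (hpow : ∀ w, h w ^ d = ((b w : ℂ) ^ d) • (1 : Matrix (Fin N) (Fin N) ℂ))
    (hcd : ∀ u w, dir u w → h u * h w = omegaD d • (h w * h u))
    (hcn : ∀ u w, u ≠ w → ¬ G.Adj u w → h u * h w = h w * h u)
    (χ : Matrix (Fin N) (Fin N) ℂ) (hχ : IsUnit χ)
    (hχcomm : ∀ u, u ≠ v → χ * h u = h u * χ)
    (hχv : h v * χ = omegaD d • (χ * h v))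
    (εk : ℂ) (hεk : εk ≠ 0)
    (hZk : indepPoly G (fun w => (b w : ℂ) ^ d) Finset.univ (-(εk ^ (-(d : ℤ)))) = 0)
    (εl : ℂ) (hεl : εl ≠ 0)
    (hZl : indepPoly G (fun w => (b w : ℂ) ^ d) Finset.univ (-(εl ^ (-(d : ℤ)))) = 0)
    (Nk : ℂ) (hNk : Nk ≠ 0) (Nl : ℂ) (hNl : Nl ≠ 0) :
    (εk ^ d ≠ εl ^ d →
      ∀ p q : ℤ,
        (omegaD d ^ p * εk - omegaD d ^ (q + 1) * εl) •
            (paraMode d G h χ εk Nk p * paraMode d G h χ εl Nl q) =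
          -((omegaD d ^ q * εl - omegaD d ^ (p + 1) * εk) •
            (paraMode d G h χ εl Nl q * paraMode d G h χ εk Nk p))) ∧
      (∀ p q : ℤ, ((p : ZMod d) ≠ ((q + 1 : ℤ) : ZMod d)) →
        paraMode d G h χ εk Nk p * paraMode d G h χ εk Nk q = 0) := by
  have hω : IsPrimitiveRoot (omegaD d) d := Complex.isPrimitiveRoot_exp d (by omega)
  have hω0 : omegaD d ≠ 0 := Complex.exp_ne_zero _
  obtain ⟨_, hcl, hfwd⟩ := hopeo
  -- orientation facts
  have hirr : ∀ u, ¬ dir u u := fun u hu => lt_irrefl _ (hfwd u u hu)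
  have hor : ∀ u w, G.Adj u w → dir u w ∨ dir w u := by
    intro u w huw
    by_cases hwu : dir w u
    · exact Or.inr hwu
    · exact Or.inl ((hdir' u w huw).mpr hwu)
  have hin : ∀ v u w, dir u v → dir w v → u ≠ w → G.Adj u w := fun v u w hu hw huw =>
    hcl v u w (hdir _ _ hu) (hdir _ _ hw) (hfwd _ _ hu) (hfwd _ _ hw) huw
  have hout : ∀ u v w, dir u v → dir u w → v ≠ w → G.Adj v w := by
    intro u a c ha hc hac
    by_contra hnadj
    have hua := hdir _ _ ha
    have huc := hdir _ _ hc
    have hnac : ¬ G.Adj c a := fun hh => hnadj hh.symm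
    have hpath : IsInducedPath G (n := 2) ![a, u, c] := by
      constructor
      · intro i j hij
        fin_cases i <;> fin_cases j <;> simp_all [hua.ne, hua.ne', huc.ne, huc.ne']
      · intro i j
        fin_cases i <;> fin_cases j <;> simp [hua, huc, hua.symm, huc.symm, hnadj, hnac]
    rcases hdip 2 _ hpath with hh | hh
    · have h0 : dir a u := hh 0
      exact lt_asymm (hfwd _ _ h0) (hfwd _ _ ha)
    · have h0 : dir c u := hh 1
      exact lt_asymm (hfwd _ _ h0) (hfwd _ _ hc)
  have hsink : ∀ A : Finset V, A.Nonempty → ∃ v ∈ A, ∀ u ∈ A, ¬ dir v u := by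
    intro A hA
    obtain ⟨a, ha, hmax⟩ := A.exists_max_image f hA
    exact ⟨a, ha, fun u hu hd' => absurd (hfwd _ _ hd') (not_lt.mpr (hmax u hu))⟩
  have hall := fun A : Finset V => tOp_exchange (omegaD d) G dir hirr hor hin hout hsink h hcd hcn
    A.card A le_rfl
  have hvs : ∀ u ∈ (Finset.univ : Finset V), ¬ dir v u := by
    intro u _ hvu
    have h1 := hfwd _ _ hvu
    by_cases huv : u = v
    · subst huv; exact lt_irrefl _ h1
    · exact lt_asymm h1 (hlast u huv)
  have hdp : ∀ x : ℂ, x ≠ 0 → _ := fun x hx => tOp_dprod d hd (omegaD d) hω G dir hsink h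
    (fun w => (b w : ℂ) ^ d) hpow hcn (fun A => (hall A).2) x hx _ Finset.univ le_rfl
  -- notation
  set T : ℂ → Matrix (Fin N) (Fin N) ℂ := tOp G h Finset.univ with hTdef
  set S : ℂ → Matrix (Fin N) (Fin N) ℂ := transferTsucc d G h Finset.univ 0 with hSdef
  set A0 : ℂ → Matrix (Fin N) (Fin N) ℂ := tOp G h (Finset.univ.erase v) with hAdef
  set B0 : ℂ → Matrix (Fin N) (Fin N) ℂ := fun x => h v * tOp G h (nonNb G Finset.univ v) x
    with hBdef
  have hTT : ∀ x y, T x * T y = T y * T x := (hall Finset.univ).1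
  have hTAB : ∀ x, T x = A0 x - x • B0 x := fun x =>
    tOp_rec G h hcn Finset.univ v (Finset.mem_univ v) x
  have hAA : ∀ x y, A0 x * A0 y = A0 y * A0 x := (hall (Finset.univ.erase v)).1
  have hDh : ∀ u ∈ nonNb G Finset.univ v, h u * h v = h v * h u := fun u hu =>
    hcn u v (mem_nonNb.mp hu).2.1 (mem_nonNb.mp hu).2.2
  have hBB : ∀ x y, B0 x * B0 y = B0 y * B0 x := fun x y =>
    hBcomm _ _ _ (tOp_commute G h (h v) _ hDh x) (tOp_commute G h (h v) _ hDh y)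
      ((hall (nonNb G Finset.univ v)).1 x y)
  have hAc : ∀ x, A0 x * χ = χ * A0 x := fun x =>
    tOp_commute G h χ _ (fun u hu => (hχcomm u (Finset.mem_erase.mp hu).1).symm) x
  have hBc : ∀ x, B0 x * χ = omegaD d • (χ * B0 x) := by
    intro x
    simp only [hBdef]
    rw [mul_assoc, tOp_commute G h χ _ (fun u hu => (hχcomm u (mem_nonNb.mp hu).2.1).symm) x,
      ← mul_assoc, hχv, smul_mul_assoc, mul_assoc]
  have hSl : ∀ x, S x = ((List.range (d - 1)).map
      (fun m => T ((omegaD d)⁻¹ ^ (m + 1) * x))).prod := by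
    intro x
    rw [hSdef, tsucc_eq]
    congr 1
    refine List.map_congr_left fun m _ => ?_
    rw [transferT_eq, mul_comm, zero_add, zpow_neg, inv_pow]
    norm_cast
  have hTS : ∀ x y, T x * S y = S y * T x := by
    intro x y
    rw [hSl y]
    refine Commute.list_prod_right _ _ fun c hc => ?_
    obtain ⟨m, _, rfl⟩ := List.mem_map.mp hc
    exact hTT _ _
  have hSS : ∀ x y, S x * S y = S y * S x := by
    intro x y
    rw [hSl y]
    refine Commute.list_prod_right _ _ fun c hc => ?_
    obtain ⟨m, _, rfl⟩ := List.mem_map.mp hc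
    exact (hTS _ _).symm
  have hTSz : ∀ x, x ≠ 0 → T x * S x = indepPoly G (fun w => (b w : ℂ) ^ d) Finset.univ (-(x ^ d)) •
      (1 : Matrix (Fin N) (Fin N) ℂ) := by
    intro x hx
    rw [← hdp x hx, ← dprod_eq_list _ (fun m n => hTT _ _), hSl]
    obtain ⟨e, rfl⟩ : ∃ e, d = e + 1 := ⟨d - 1, by omega⟩
    rw [List.range_succ_eq_map]
    simp [List.map_map, Function.comp_def]
  -- the mixed exchange relation, first generically and then by continuity
  have hK2 : ∀ x y : ℂ,
      (x - omegaD d * y) • (χ * (T y * S x)) + (omegaD d * x - y) • (S x * T y * χ)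
      = (x - y) • (T y * χ * S x + omegaD d • (S x * χ * T y)) := by
    intro x y
    have hScont : Continuous S := tsucc_continuous d G h Finset.univ
    refine congrFun (Continuous.ext_on
      (dense_good d hd G (fun w => (b w : ℂ) ^ d) Finset.univ)
      (f := fun x => (x - omegaD d * y) • (χ * (T y * S x)) + (omegaD d * x - y) • (S x * T y * χ))
      (g := fun x => (x - y) • (T y * χ * S x + omegaD d • (S x * χ * T y)))
      (by fun_prop) (by fun_prop) ?_) x
    rintro t ⟨ht0, htz⟩
    refine alg_K2 (omegaD d) t y _ htz χ (T t) (T y) (S t) (hTSz t ht0)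
      ((hTS t t).symm.trans (hTSz t ht0)) (hTT t y) ?_
    have hT' := hTT t y
    rw [hTAB t, hTAB y] at hT' ⊢
    exact alg_K (omegaD d) t y χ _ _ _ _ (hAA t y) (hBB t y) (hAc t) (hAc y) (hBc t) (hBc y)
      ((hall Finset.univ).2 v (Finset.mem_univ v) hvs t y) hT'
  have hmode : ∀ (ε n : ℂ) (p : ℤ), paraMode d G h χ ε n p =
      n⁻¹ • (T (ε⁻¹ * omegaD d ^ (-p)) * χ * S (ε⁻¹ * omegaD d ^ (-p))) := by
    intro ε n p
    unfold paraMode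
    rw [transferT_eq, tsucc_shift d G h _ hd]
  have hωp : ∀ p : ℤ, (omegaD d ^ p) ^ d = 1 := by
    intro p
    rw [← zpow_natCast, ← zpow_mul, mul_comm, zpow_mul, zpow_natCast, hω.pow_eq_one, one_zpow]
  have hzero : ∀ (ε : ℂ) (p : ℤ), ε ≠ 0 →
      indepPoly G (fun w => (b w : ℂ) ^ d) Finset.univ (-(ε ^ (-(d : ℤ)))) = 0 →
      T (ε⁻¹ * omegaD d ^ (-p)) * S (ε⁻¹ * omegaD d ^ (-p)) = 0 := by
    intro ε p hε hZ
    rw [hTSz _ (mul_ne_zero (inv_ne_zero hε) (zpow_ne_zero _ hω0)), mul_pow, hωp, mul_one, inv_pow,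
      ← zpow_natCast, ← zpow_neg, hZ, zero_smul]
  constructor
  · intro _ p q
    rw [hmode, hmode]
    have hx0 : εk⁻¹ * omegaD d ^ (-p) ≠ 0 := mul_ne_zero (inv_ne_zero hεk) (zpow_ne_zero _ hω0)
    have hy0 : εl⁻¹ * omegaD d ^ (-q) ≠ 0 := mul_ne_zero (inv_ne_zero hεl) (zpow_ne_zero _ hω0)
    have hx := hzero εk p hεk hZk
    have hy := hzero εl q hεl hZl
    have hex : omegaD d ^ p * εk = (εk⁻¹ * omegaD d ^ (-p))⁻¹ := by
      rw [mul_inv, inv_inv, zpow_neg, inv_inv, mul_comm]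
    have hey : omegaD d ^ q * εl = (εl⁻¹ * omegaD d ^ (-q))⁻¹ := by
      rw [mul_inv, inv_inv, zpow_neg, inv_inv, mul_comm]
    rw [zpow_add_one₀ hω0, zpow_add_one₀ hω0, mul_right_comm (omegaD d ^ q),
      mul_right_comm (omegaD d ^ p), hex, hey]
    generalize εk⁻¹ * omegaD d ^ (-p) = x at *
    generalize εl⁻¹ * omegaD d ^ (-q) = y at *
    have E1 := alg_final1 (omegaD d) x y χ (T x) (T y) (S x) (S y) hy (hSS x y) (hK2 x y)
    have E2 := alg_final1 (omegaD d) y x χ (T y) (T x) (S y) (S x) hx (hSS y x) (hK2 y x)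
    have E3 : T x * χ * T y * χ * (S x * S y) = T y * χ * T x * χ * (S x * S y) := by
      have hT' := hTT x y
      rw [hTAB x, hTAB y] at hT' ⊢
      rw [hTAB x] at hx
      rw [hTAB y] at hy
      exact alg_final2 (omegaD d) x y χ _ _ _ _ _ _ (hAA x y) (hBB x y) (hAc x) (hAc y) (hBc x)
        (hBc y) hT' hx hy (hSS x y)
    rw [hSS y x, ← E3] at E2
    have c1 : x⁻¹ - y⁻¹ * omegaD d = -(x⁻¹ * y⁻¹) * (omegaD d * x - y) := by
      field_simp; ring
    have c2 : y⁻¹ - x⁻¹ * omegaD d = -(x⁻¹ * y⁻¹) * (omegaD d * y - x) := by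
      field_simp; ring
    rw [c1, c2]
    simp only [smul_mul_assoc, mul_smul_comm] at E1 E2 ⊢
    linear_combination (norm := module) (-(x⁻¹ * y⁻¹ * Nk⁻¹ * Nl⁻¹)) • E1
      - (x⁻¹ * y⁻¹ * Nk⁻¹ * Nl⁻¹) • E2
  · intro p q hpq
    rw [hmode, hmode]
    have hy := hzero εk q hεk hZk
    have hne : omegaD d * (εk⁻¹ * omegaD d ^ (-p)) - εk⁻¹ * omegaD d ^ (-q) ≠ 0 := by
      intro h0
      have h1 : εk⁻¹ * (omegaD d * omegaD d ^ (-p)) = εk⁻¹ * omegaD d ^ (-q) := by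
        linear_combination h0
      have h2 := mul_left_cancel₀ (inv_ne_zero hεk) h1
      have h3 : omegaD d ^ (q + 1 - p) = 1 := by
        have e : q + 1 - p = q + (1 + -p) := by ring
        rw [e, zpow_add₀ hω0, zpow_add₀ hω0, zpow_one, h2, ← zpow_add₀ hω0]
        simp
      have h4 := (hω.zpow_eq_one_iff_dvd _).mp h3
      apply hpq
      rw [ZMod.intCast_eq_intCast_iff_dvd_sub]
      exact h4
    have E1 := alg_final1 (omegaD d) (εk⁻¹ * omegaD d ^ (-p)) (εk⁻¹ * omegaD d ^ (-q)) χ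
      (T (εk⁻¹ * omegaD d ^ (-p))) (T (εk⁻¹ * omegaD d ^ (-q)))
      (S (εk⁻¹ * omegaD d ^ (-p))) (S (εk⁻¹ * omegaD d ^ (-q))) hy (hSS _ _) (hK2 _ _)
    have hR0 : (εk⁻¹ * omegaD d ^ (-p) - εk⁻¹ * omegaD d ^ (-q)) •
        (T (εk⁻¹ * omegaD d ^ (-p)) * χ * T (εk⁻¹ * omegaD d ^ (-q)) * χ *
          (S (εk⁻¹ * omegaD d ^ (-p)) * S (εk⁻¹ * omegaD d ^ (-q)))) = 0 := by
      have hd0 : (d : ℤ) ≠ 0 := by omega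
      have hdec : omegaD d ^ (q - p) = omegaD d ^ ((q - p) % d) := by
        conv_lhs => rw [← Int.emod_add_mul_ediv (q - p) d]
        rw [zpow_add₀ hω0, zpow_mul, zpow_natCast, hω.pow_eq_one, one_zpow, mul_one]
      have hxy : εk⁻¹ * omegaD d ^ (-p) = omegaD d ^ ((q - p) % d) * (εk⁻¹ * omegaD d ^ (-q)) := by
        rw [← hdec, mul_left_comm, ← zpow_add₀ hω0]
        congr 2
        ring
      have hr1 := Int.emod_nonneg (q - p) hd0
      have hr2 := Int.emod_lt_of_pos (q - p) (b := (d : ℤ)) (by omega)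
      obtain ⟨r, hr⟩ := Int.eq_ofNat_of_zero_le hr1
      rw [hr] at hxy hr2
      rcases Nat.eq_zero_or_pos r with hr0 | hr0
      · subst hr0
        rw [hxy]
        simp
      · have : S (εk⁻¹ * omegaD d ^ (-p)) * S (εk⁻¹ * omegaD d ^ (-q)) = 0 := by
          rw [hSl (εk⁻¹ * omegaD d ^ (-p))]
          refine list_prod_mul_zero _ (T (εk⁻¹ * omegaD d ^ (-q))) _ ?_ ?_ hy
          · intro c hc
            obtain ⟨m, _, rfl⟩ := List.mem_map.mp hc
            exact hTS _ _
          · refine List.mem_map.mpr ⟨r - 1, List.mem_range.mpr (by omega), ?_⟩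
            rw [hxy, Nat.sub_add_cancel hr0, ← mul_assoc, zpow_natCast, inv_pow,
              inv_mul_cancel₀ (pow_ne_zero _ hω0), one_mul]
        rw [this, mul_zero, smul_zero]
    rw [hR0] at E1
    rw [smul_mul_assoc, mul_smul_comm, (smul_eq_zero.mp E1).resolve_left hne, smul_zero, smul_zero]
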